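/- Let d ≥ 1 and 1 ≤ q < 2d. There is a constant C > 0 depending only on d and q with the following property: for every x ∈ ℂ^d, every integer n ≥ 1, every compact set K ⊆ {z ∈ ℂ^d : 2^{−(n+1)} ≤ |z − x| ≤ 2^{−n}}, and every ε > 0, there exists a Lipschitz function φ : ℂ^d → ℝ with compact support contained in {z : 2^{−(n+2)} ≤ |z − x| ≤ 2^{−(n−1)}} such that φ = 1 on K and ∫_{ℂ^d} |∇φ|^q dV ≤ C(Γ_q(K) + ε). -/

import Mathlib

open MeasureTheory
open scoped ENNReal NNReal

noncomputable instance (d : ℕ) : MeasurableSpace (EuclideanSpace ℂ (Fin d)) := borel _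
instance (d : ℕ) : BorelSpace (EuclideanSpace ℂ (Fin d)) := ⟨rfl⟩

/-- The Sobolev `q`-capacity of a compact set `K`: the infimum of `∫ |∇u|^q dV` over all
Lipschitz functions `u` with compact support satisfying `u ≥ 1` on `K`.  (At points where a
Lipschitz function is not differentiable, `fderiv` takes the junk value `0`; by Rademacher's
theorem this agrees a.e. with the gradient.) -/
noncomputable def capCompact {E : Type*} [NormedAddCommGroup E] [NormedSpace ℝ E]
    [MeasureSpace E] (q : ℝ) (K : Set E) : ℝ :=
  sInf { t : ℝ | ∃ u : E → ℝ, (∃ L, LipschitzWith L u) ∧ HasCompactSupport u ∧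
    (∀ z ∈ K, 1 ≤ u z) ∧ t = ∫ z, ‖fderiv ℝ u z‖ ^ q }

open Set Filter Topology Module

theorem rpow_lintegral_le_measure_univ_rpow_mul {α : Type*} [MeasurableSpace α] {m : Measure α}
    {q : ℝ} (hq : 1 ≤ q) {f : α → ℝ≥0∞} (hf : AEMeasurable f m) :
    (∫⁻ a, f a ∂m) ^ q ≤ m univ ^ (q - 1) * ∫⁻ a, f a ^ q ∂m := by
  have hq0 : 0 < q := by linarith
  have h := eLpNorm'_le_eLpNorm'_mul_rpow_measure_univ (μ := m) (f := f) zero_lt_one hq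
    hf.aestronglyMeasurable
  simp only [eLpNorm', enorm_eq_self, ENNReal.rpow_one, div_one] at h
  calc (∫⁻ a, f a ∂m) ^ q
      ≤ ((∫⁻ a, f a ^ q ∂m) ^ (1 / q) * m univ ^ (1 - 1 / q)) ^ q := ENNReal.rpow_le_rpow h hq0.le
    _ = m univ ^ (q - 1) * ∫⁻ a, f a ^ q ∂m := by
      rw [ENNReal.mul_rpow_of_nonneg _ _ hq0.le, ← ENNReal.rpow_mul, ← ENNReal.rpow_mul,
        one_div_mul_cancel hq0.ne', ENNReal.rpow_one, mul_comm]
      congr 2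
      field_simp

theorem rpow_setLIntegral_Ioi_le {q b : ℝ} (hq : 1 ≤ q) {g : ℝ → ℝ≥0∞} (hg : Measurable g) :
    (∫⁻ t in Ioi (1 : ℝ), g t) ^ q ≤
      (∫⁻ t in Ioi (1 : ℝ), ENNReal.ofReal (t ^ (-b))) ^ (q - 1) *
        ∫⁻ t in Ioi (1 : ℝ), ENNReal.ofReal (t ^ (b * (q - 1))) * g t ^ q := by
  have hw : Measurable fun t : ℝ => ENNReal.ofReal (t ^ (-b)) := by fun_prop
  have hv : Measurable fun t : ℝ => ENNReal.ofReal (t ^ b) := by fun_prop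
  have h := rpow_lintegral_le_measure_univ_rpow_mul
    (m := (volume.restrict (Ioi (1 : ℝ))).withDensity fun t => ENNReal.ofReal (t ^ (-b))) hq
    (hv.mul hg).aemeasurable
  rw [lintegral_withDensity_eq_lintegral_mul _ hw (hv.mul hg),
    lintegral_withDensity_eq_lintegral_mul _ hw ((hv.mul hg).pow_const q),
    withDensity_apply _ MeasurableSet.univ, Measure.restrict_univ] at h
  convert h using 2
  · refine setLIntegral_congr_fun measurableSet_Ioi fun t ht => ?_
    have ht0 : 0 < t := lt_trans zero_lt_one ht
    simp only [Pi.mul_apply]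
    rw [← mul_assoc, ← ENNReal.ofReal_mul (by positivity), ← Real.rpow_add ht0]
    simp
  · refine setLIntegral_congr_fun measurableSet_Ioi fun t ht => ?_
    have ht0 : 0 < t := lt_trans zero_lt_one ht
    simp only [Pi.mul_apply]
    rw [ENNReal.mul_rpow_of_nonneg _ _ (by linarith), ← mul_assoc,
      ENNReal.ofReal_rpow_of_pos (by positivity),
      ← ENNReal.ofReal_mul (by positivity), ← Real.rpow_mul ht0.le, ← Real.rpow_add ht0]
    ring_nf

theorem norm_fderiv_min_mul_one_le {E : Type*} [NormedAddCommGroup E] [NormedSpace ℝ E]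
    {u χ : E → ℝ} {L : ℝ≥0} {z : E} (hu : DifferentiableAt ℝ u z) (hχ : LipschitzWith L χ)
    (hχ1 : ∀ y, |χ y| ≤ 1) :
    ‖fderiv ℝ (fun y => min (u y * χ y) 1) z‖ ≤ ‖fderiv ℝ u z‖ + L * ‖u z‖ := by
  refine le_of_forall_pos_le_add fun δ hδ => norm_fderiv_le_of_lip' ℝ (by positivity) ?_
  filter_upwards [hu.hasFDerivAt.isLittleO.def hδ] with y hy
  have h1 : ‖u y - u z‖ ≤ (‖fderiv ℝ u z‖ + δ) * ‖y - z‖ := by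
    calc ‖u y - u z‖ ≤ ‖u y - u z - fderiv ℝ u z (y - z)‖ + ‖fderiv ℝ u z (y - z)‖ := by
          simpa using norm_add_le (u y - u z - fderiv ℝ u z (y - z)) (fderiv ℝ u z (y - z))
      _ ≤ δ * ‖y - z‖ + ‖fderiv ℝ u z‖ * ‖y - z‖ :=
          add_le_add hy (ContinuousLinearMap.le_opNorm _ _)
      _ = _ := by ring
  have h2 : ‖χ y - χ z‖ ≤ L * ‖y - z‖ := hχ.norm_sub_le y z
  calc ‖min (u y * χ y) 1 - min (u z * χ z) 1‖
      ≤ ‖u y * χ y - u z * χ z‖ := by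
        simpa using abs_min_sub_min_le_max (u y * χ y) 1 (u z * χ z) 1
    _ = ‖χ y * (u y - u z) + u z * (χ y - χ z)‖ := by congr 1; ring
    _ ≤ ‖χ y‖ * ‖u y - u z‖ + ‖u z‖ * ‖χ y - χ z‖ := by
        simpa only [norm_mul] using norm_add_le (χ y * (u y - u z)) (u z * (χ y - χ z))
    _ ≤ 1 * ((‖fderiv ℝ u z‖ + δ) * ‖y - z‖) + ‖u z‖ * (L * ‖y - z‖) := by
        gcongr
        exact hχ1 y
    _ = _ := by ring

theorem LipschitzWith.mul_of_abs_le {X : Type*} [PseudoMetricSpace X] {f g : X → ℝ}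
    {K L M N : ℝ≥0} (hf : LipschitzWith K f) (hg : LipschitzWith L g) (hfM : ∀ x, |f x| ≤ M)
    (hgN : ∀ x, |g x| ≤ N) : LipschitzWith (N * K + M * L) fun x => f x * g x := by
  refine LipschitzWith.of_dist_le_mul fun x y => ?_
  have h1 := hf.dist_le_mul x y
  have h2 := hg.dist_le_mul x y
  rw [Real.dist_eq] at h1 h2 ⊢
  calc |f x * g x - f y * g y| = |g x * (f x - f y) + f y * (g x - g y)| := by congr 1; ring
    _ ≤ |g x| * |f x - f y| + |f y| * |g x - g y| := by
        simpa only [abs_mul] using abs_add_le (g x * (f x - f y)) (f y * (g x - g y))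
    _ ≤ N * (K * dist x y) + M * (L * dist x y) := by
        gcongr
        exacts [hgN x, hfM y]
    _ = _ := by push_cast; ring

theorem exists_lipschitz_annular_cutoff {X : Type*} [PseudoMetricSpace X] (x : X) {s : ℝ}
    (hs : 0 < s) : ∃ χ : X → ℝ, LipschitzWith (4 / s).toNNReal χ ∧ (∀ z, |χ z| ≤ 1) ∧
      (∀ z, s / 2 ≤ dist z x → dist z x ≤ s → χ z = 1) ∧
      ∀ z, χ z ≠ 0 → s / 4 ≤ dist z x ∧ dist z x ≤ 2 * s := by
  refine ⟨fun z => max 0 (min 1 (min (4 / s * dist z x - 1) (2 - dist z x / s))), ?_,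
    fun z => ?_, fun z h1 h2 => ?_, fun z hz => ?_⟩
  · have hK : ((4 / s).toNNReal : ℝ) = 4 / s := Real.coe_toNNReal _ (by positivity)
    have h1 : LipschitzWith (4 / s).toNNReal fun z => 4 / s * dist z x - 1 := by
      refine LipschitzWith.of_le_add_mul _ fun a b => ?_
      rw [hK]
      have := mul_le_mul_of_nonneg_left (dist_triangle a b x) (by positivity : 0 ≤ 4 / s)
      linarith
    have h2 : LipschitzWith (4 / s).toNNReal fun z => 2 - dist z x / s := by
      refine LipschitzWith.of_le_add_mul _ fun a b => ?_
      rw [hK]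
      have h := div_le_div_of_nonneg_right (dist_triangle_left b x a) hs.le
      have h' : dist a b / s ≤ 4 / s * dist a b := by
        rw [div_mul_eq_mul_div]
        gcongr
        linarith [dist_nonneg (x := a) (y := b)]
      rw [add_div] at h
      linarith
    simpa using ((h1.min h2).const_min 1).const_max 0
  · rw [abs_of_nonneg (le_max_left _ _)]
    exact max_le zero_le_one (min_le_left _ _)
  · have h3 : 1 ≤ 4 / s * dist z x - 1 := by
      have : 4 / s * (s / 2) = 2 := by field_simp; norm_num
      have := mul_le_mul_of_nonneg_left h1 (by positivity : 0 ≤ 4 / s)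
      linarith
    have h4 : 1 ≤ 2 - dist z x / s := by
      have : dist z x / s ≤ 1 := (div_le_one hs).2 h2
      linarith
    simp [h3, h4]
  · have hpos : 0 < min 1 (min (4 / s * dist z x - 1) (2 - dist z x / s)) := by
      by_contra! h
      exact hz (max_eq_left h)
    rw [lt_min_iff, lt_min_iff] at hpos
    obtain ⟨-, h1, h2⟩ := hpos
    constructor
    · rw [div_mul_eq_mul_div, sub_pos, lt_div_iff₀ hs] at h1
      linarith
    · rw [sub_pos, div_lt_iff₀ hs] at h2
      exact h2.le

theorem LipschitzWith.ofReal_integral_norm_fderiv_rpow {E : Type*} [NormedAddCommGroup E]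
    [NormedSpace ℝ E] [MeasurableSpace E] [BorelSpace E] (μ : Measure E)
    [IsFiniteMeasureOnCompacts μ] {q : ℝ} (hq : 0 < q)
    {u : E → ℝ} {L : ℝ≥0} (hu : LipschitzWith L u) (hc : HasCompactSupport u) :
    ENNReal.ofReal (∫ z, ‖fderiv ℝ u z‖ ^ q ∂μ) = ∫⁻ z, ‖fderiv ℝ u z‖ₑ ^ q ∂μ := by
  have hm : Measurable fun z => ‖fderiv ℝ u z‖ ^ q := (measurable_fderiv ℝ u).norm.pow_const q
  have hint : Integrable (fun z => ‖fderiv ℝ u z‖ ^ q) μ := by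
    rw [← integrableOn_iff_integrable_of_support_subset (s := tsupport u)]
    · refine Measure.integrableOn_of_bounded (M := L ^ q) hc.isCompact.measure_lt_top.ne
        hm.aestronglyMeasurable (Eventually.of_forall fun z => ?_)
      rw [Real.norm_of_nonneg (by positivity)]
      gcongr
      exact norm_fderiv_le_of_lipschitz ℝ hu
    · intro z hz
      refine support_fderiv_subset ℝ fun h0 => hz ?_
      simp [h0, hq.ne']
  rw [ofReal_integral_eq_lintegral_ofReal hint (Eventually.of_forall fun z => by positivity)]
  refine lintegral_congr fun z => ?_
  rw [← ENNReal.ofReal_rpow_of_nonneg (norm_nonneg _) hq.le, ofReal_norm]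

section

variable {E : Type*} [NormedAddCommGroup E] [NormedSpace ℝ E] [FiniteDimensional ℝ E]
  [MeasurableSpace E] [BorelSpace E] (μ : Measure E) [μ.IsAddHaarMeasure]

theorem lintegral_comp_add_smul {f : E → ℝ≥0∞} (hf : Measurable f) (x : E) {t : ℝ}
    (ht : 0 < t) :
    ∫⁻ z, f (x + t • z) ∂μ = ENNReal.ofReal (t ^ (-(finrank ℝ E : ℝ))) * ∫⁻ z, f z ∂μ := by
  have h := lintegral_map (μ := μ) (f := fun y => f (x + y)) (by fun_prop)
    (measurable_const_smul t)
  rw [← h, Measure.map_addHaar_smul μ ht.ne', lintegral_smul_measure,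
    lintegral_add_left_eq_self, Real.rpow_neg ht.le, Real.rpow_natCast,
    abs_of_nonneg (by positivity), smul_eq_mul]

theorem LipschitzWith.ae_enorm_le_lintegral_fderiv [Nontrivial E] {u : E → ℝ} {L : ℝ≥0}
    (hu : LipschitzWith L u) (hc : HasCompactSupport u) (x : E) :
    ∀ᵐ z ∂μ, ‖u (x + z)‖ₑ ≤
      ‖z‖ₑ * ∫⁻ t in Ioi (1 : ℝ), ‖fderiv ℝ u (x + t • z)‖ₑ := by
  have hmeas : MeasurableSet {p : ℝ × E | DifferentiableAt ℝ u (x + p.1 • p.2)} :=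
    (measurableSet_of_differentiableAt ℝ u).preimage
      (f := fun p : ℝ × E => x + p.1 • p.2) (by fun_prop)
  have hdiff : ∀ᵐ z ∂μ, ∀ᵐ t ∂(volume.restrict (Ioi (1 : ℝ))),
      DifferentiableAt ℝ u (x + t • z) := by
    rw [← Measure.ae_ae_comm (p := fun t z => DifferentiableAt ℝ u (x + t • z)) hmeas]
    filter_upwards [ae_restrict_mem measurableSet_Ioi] with t ht
    have ht0 : t ≠ 0 := (lt_trans zero_lt_one ht).ne'
    exact ((quasiMeasurePreserving_add_left μ x).comp
      (Measure.quasiMeasurePreserving_smul μ ht0)).ae (hu.ae_differentiableAt (μ := μ))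
  filter_upwards [hdiff, compl_mem_ae_iff.2 (measure_singleton (μ := μ) 0)] with z hz hz0
  obtain ⟨T, hT1, hT⟩ : ∃ T : ℝ, 1 < T ∧ u (x + T • z) = 0 := by
    obtain ⟨R, hR⟩ := hc.isCompact.isBounded.subset_closedBall x
    have hzn : 0 < ‖z‖ := norm_pos_iff.2 hz0
    refine ⟨max 1 (R / ‖z‖) + 1, by linarith [le_max_left 1 (R / ‖z‖)], ?_⟩
    by_contra hne
    have := hR (subset_tsupport u hne)
    rw [mem_closedBall_iff_norm, add_sub_cancel_left, norm_smul, Real.norm_eq_abs,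
      abs_of_nonneg (by positivity), ← le_div_iff₀ hzn] at this
    linarith [le_max_right 1 (R / ‖z‖)]
  have hline : LipschitzWith (L * ‖z‖₊) fun t : ℝ => u (x + t • z) := by
    refine hu.comp (LipschitzWith.of_dist_le_mul fun s t => ?_)
    rw [dist_add_left, dist_eq_norm, ← sub_smul, norm_smul, mul_comm]
    rfl
  have hFTC := (hline.lipschitzOnWith (s := uIcc 1 T)).absolutelyContinuousOnInterval
    |>.integral_deriv_eq_sub
  rw [hT, zero_sub, one_smul, intervalIntegral.integral_of_le hT1.le] at hFTC
  rw [← enorm_neg, ← hFTC]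
  calc _ ≤ ∫⁻ t in Ioc 1 T, ‖deriv (fun t : ℝ => u (x + t • z)) t‖ₑ :=
        enorm_integral_le_lintegral_enorm _
    _ ≤ ∫⁻ t in Ioi (1 : ℝ), ‖deriv (fun t : ℝ => u (x + t • z)) t‖ₑ :=
        lintegral_mono_set Ioc_subset_Ioi_self
    _ ≤ ∫⁻ t in Ioi (1 : ℝ), ‖z‖ₑ * ‖fderiv ℝ u (x + t • z)‖ₑ := by
        refine lintegral_mono_ae ?_
        filter_upwards [hz] with t ht
        have hd : HasDerivAt (fun t : ℝ => x + t • z) z t := by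
          simpa using ((hasDerivAt_id t).smul_const z).const_add x
        have hd' := ht.hasFDerivAt.comp_hasDerivAt t hd
        rw [Function.comp_def] at hd'
        rw [hd'.deriv, mul_comm]
        exact ContinuousLinearMap.le_opENorm _ _
    _ = _ := lintegral_const_mul' _ _ (by simp)

theorem exists_setLIntegral_closedBall_rpow_le {q : ℝ} (hq1 : 1 ≤ q) (hq2 : q < finrank ℝ E) :
    ∃ C : ℝ≥0∞, C ≠ ⊤ ∧ ∀ (u : E → ℝ) (L : ℝ≥0), LipschitzWith L u → HasCompactSupport u →
      ∀ (x : E) (R : ℝ), ∫⁻ z in Metric.closedBall x R, ‖u z‖ₑ ^ q ∂μ ≤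
        C * (ENNReal.ofReal R ^ q * ∫⁻ z, ‖fderiv ℝ u z‖ₑ ^ q ∂μ) := by
  have hq0 : 0 ≤ q := by linarith
  have : Nontrivial E := nontrivial_of_finrank_pos (R := ℝ) (by
    have : (0 : ℝ) < finrank ℝ E := by linarith
    exact_mod_cast this)
  obtain ⟨b, hb1, hb2⟩ : ∃ b : ℝ, 1 < b ∧ b * (q - 1) < finrank ℝ E - 1 := by
    refine ⟨1 + (finrank ℝ E - q) / (2 * q), ?_, ?_⟩
    · have : 0 < (finrank ℝ E - q) / (2 * q) := by apply div_pos <;> linarith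
      linarith
    · have : (finrank ℝ E - q) / (2 * q) * (q - 1) < finrank ℝ E - q := by
        rw [div_mul_eq_mul_div, div_lt_iff₀ (by linarith)]
        nlinarith
      linarith
  have hfin : ∀ a : ℝ, a < -1 → ∫⁻ t in Ioi (1 : ℝ), ENNReal.ofReal (t ^ a) ≠ ⊤ := fun a ha =>
    ((integrableOn_Ioi_rpow_of_lt ha one_pos).lintegral_lt_top).ne
  set A := ∫⁻ t in Ioi (1 : ℝ), ENNReal.ofReal (t ^ (-b))
  set B := ∫⁻ t in Ioi (1 : ℝ), ENNReal.ofReal (t ^ (b * (q - 1) - finrank ℝ E)) with hB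
  refine ⟨A ^ (q - 1) * B, ENNReal.mul_ne_top
    (ENNReal.rpow_ne_top_of_nonneg (by linarith) (hfin _ (by linarith)))
    (hfin _ (by linarith)), fun u L hu hc x R => ?_⟩
  have hG : Measurable fun z => ‖fderiv ℝ u z‖ₑ := (measurable_fderiv ℝ u).enorm
  calc ∫⁻ z in Metric.closedBall x R, ‖u z‖ₑ ^ q ∂μ
      = ∫⁻ z, (Metric.closedBall x R).indicator (fun z => ‖u z‖ₑ ^ q) (x + z) ∂μ := by
        rw [lintegral_add_left_eq_self, lintegral_indicator Metric.isClosed_closedBall.measurableSet]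
    _ ≤ ∫⁻ z, ENNReal.ofReal R ^ q * A ^ (q - 1) * (∫⁻ t in Ioi (1 : ℝ),
          ENNReal.ofReal (t ^ (b * (q - 1))) * ‖fderiv ℝ u (x + t • z)‖ₑ ^ q) ∂μ := by
        refine lintegral_mono_ae ?_
        filter_upwards [hu.ae_enorm_le_lintegral_fderiv μ hc x] with z hz
        refine indicator_apply_le' (fun hzR => ?_) (fun _ => zero_le)
        rw [mem_closedBall_iff_norm, add_sub_cancel_left] at hzR
        have hzR' : ‖z‖ₑ ≤ ENNReal.ofReal R := by
          rw [← ofReal_norm]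
          exact ENNReal.ofReal_le_ofReal hzR
        calc ‖u (x + z)‖ₑ ^ q
            ≤ (ENNReal.ofReal R * ∫⁻ t in Ioi (1 : ℝ), ‖fderiv ℝ u (x + t • z)‖ₑ) ^ q := by
              gcongr
              exact hz.trans (by gcongr)
          _ ≤ _ := by
              rw [ENNReal.mul_rpow_of_nonneg _ _ hq0, mul_assoc]
              gcongr
              exact rpow_setLIntegral_Ioi_le hq1 (by fun_prop)
    _ = ENNReal.ofReal R ^ q * A ^ (q - 1) * ∫⁻ t in Ioi (1 : ℝ),
          ENNReal.ofReal (t ^ (b * (q - 1))) * ∫⁻ z, ‖fderiv ℝ u (x + t • z)‖ₑ ^ q ∂μ := by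
        have hj : Measurable fun p : E × ℝ => ‖fderiv ℝ u (x + p.2 • p.1)‖ₑ :=
          hG.comp (by fun_prop)
        rw [lintegral_const_mul _ (Measurable.lintegral_prod_right' (f := fun p : E × ℝ =>
            ENNReal.ofReal (p.2 ^ (b * (q - 1))) * ‖fderiv ℝ u (x + p.2 • p.1)‖ₑ ^ q)
            (by fun_prop)), lintegral_lintegral_swap (by
              simp only [Function.uncurry_def]; fun_prop)]
        congr 1
        refine lintegral_congr fun t => ?_
        dsimp only
        rw [lintegral_const_mul' _ _ ENNReal.ofReal_ne_top]
    _ = ENNReal.ofReal R ^ q * A ^ (q - 1) * ∫⁻ t in Ioi (1 : ℝ),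
          ENNReal.ofReal (t ^ (b * (q - 1) - finrank ℝ E)) *
            ∫⁻ z, ‖fderiv ℝ u z‖ₑ ^ q ∂μ := by
        congr 1
        refine setLIntegral_congr_fun measurableSet_Ioi fun t ht => ?_
        have ht0 : 0 < t := lt_trans zero_lt_one ht
        rw [lintegral_comp_add_smul μ (hG.pow_const q) x ht0, ← mul_assoc,
          ← ENNReal.ofReal_mul (by positivity), ← Real.rpow_add ht0, ← sub_eq_add_neg]
    _ = _ := by
        rw [lintegral_mul_const _ (by fun_prop), ← hB]
        ring

theorem exists_annular_cutoff_lintegral_le {q : ℝ} (hq1 : 1 ≤ q) (hq2 : q < finrank ℝ E) :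
    ∃ C : ℝ≥0∞, C ≠ ⊤ ∧ ∀ (u : E → ℝ) (L : ℝ≥0), LipschitzWith L u → HasCompactSupport u →
      ∀ (x : E) (s : ℝ), 0 < s → ∃ φ : E → ℝ, (∃ L, LipschitzWith L φ) ∧
        tsupport φ ⊆ {z | s / 4 ≤ dist z x ∧ dist z x ≤ 2 * s} ∧
        (∀ z, s / 2 ≤ dist z x → dist z x ≤ s → 1 ≤ u z → φ z = 1) ∧
        ∫⁻ z, ‖fderiv ℝ φ z‖ₑ ^ q ∂μ ≤ C * ∫⁻ z, ‖fderiv ℝ u z‖ₑ ^ q ∂μ := by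
  have hq0 : 0 ≤ q := by linarith
  obtain ⟨C, hC, h⟩ := exists_setLIntegral_closedBall_rpow_le μ hq1 hq2
  refine ⟨2 ^ (q - 1) * (1 + ENNReal.ofReal 8 ^ q * C), ?_, fun u L hu hc x s hs => ?_⟩
  · refine ENNReal.mul_ne_top (ENNReal.rpow_ne_top_of_nonneg (by linarith) (by simp))
      (ENNReal.add_ne_top.2 ⟨by simp, ENNReal.mul_ne_top
        (ENNReal.rpow_ne_top_of_nonneg hq0 ENNReal.ofReal_ne_top) hC⟩)
  obtain ⟨χ, hχL, hχ1, hχK, hχs⟩ := exists_lipschitz_annular_cutoff x hs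
  obtain ⟨M, hM⟩ := hc.exists_bound_of_continuous hu.continuous
  have hsupp : tsupport (fun z => min (u z * χ z) 1) ⊆
      {z | s / 4 ≤ dist z x ∧ dist z x ≤ 2 * s} := by
    refine closure_minimal (fun z hz => hχs z fun h0 => hz (by simp [h0])) ?_
    exact (isClosed_le continuous_const (continuous_id.dist continuous_const)).inter
      (isClosed_le (continuous_id.dist continuous_const) continuous_const)
  refine ⟨fun z => min (u z * χ z) 1, ⟨_, (hu.mul_of_abs_le (M := M.toNNReal) (N := 1) hχL
    (fun z => (hM z).trans (Real.le_coe_toNNReal M)) hχ1).min_const 1⟩, hsupp,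
    fun z h1 h2 h3 => by simp [hχK z h1 h2, h3], ?_⟩
  have hG : Measurable fun z => ‖fderiv ℝ u z‖ₑ ^ q := (measurable_fderiv ℝ u).enorm.pow_const q
  set B := Metric.closedBall x (2 * s)
  have hBm : MeasurableSet B := Metric.isClosed_closedBall.measurableSet
  calc ∫⁻ z, ‖fderiv ℝ (fun y => min (u y * χ y) 1) z‖ₑ ^ q ∂μ
      ≤ ∫⁻ z, 2 ^ (q - 1) * (‖fderiv ℝ u z‖ₑ ^ q +
          ENNReal.ofReal (4 / s) ^ q * B.indicator (fun z => ‖u z‖ₑ ^ q) z) ∂μ := by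
        refine lintegral_mono_ae ?_
        filter_upwards [hu.ae_differentiableAt (μ := μ)] with z hz
        by_cases hzB : z ∈ B
        · rw [indicator_of_mem hzB, ← ENNReal.mul_rpow_of_nonneg _ _ hq0]
          refine le_trans ?_ (ENNReal.rpow_add_le_mul_rpow_add_rpow _ _ hq1)
          gcongr
          have := ENNReal.ofReal_le_ofReal (norm_fderiv_min_mul_one_le hz hχL hχ1)
          rw [ENNReal.ofReal_add (by positivity) (by positivity),
            ENNReal.ofReal_mul (by positivity), ofReal_norm, ofReal_norm, ofReal_norm,
            ENNReal.ofReal_coe_nnreal] at this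
          exact this
        · have hz0 : fderiv ℝ (fun y => min (u y * χ y) 1) z = 0 := by
            by_contra hne
            exact hzB (hsupp (support_fderiv_subset ℝ hne)).2
          rw [← ofReal_norm, hz0, norm_zero, ENNReal.ofReal_zero,
            ENNReal.zero_rpow_of_pos (by linarith)]
          exact zero_le
    _ = 2 ^ (q - 1) * (∫⁻ z, ‖fderiv ℝ u z‖ₑ ^ q ∂μ +
          ENNReal.ofReal (4 / s) ^ q * ∫⁻ z in B, ‖u z‖ₑ ^ q ∂μ) := by
        rw [lintegral_const_mul' _ _ (ENNReal.rpow_ne_top_of_nonneg (by linarith) (by simp)),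
          lintegral_add_left hG, lintegral_const_mul' _ _
            (ENNReal.rpow_ne_top_of_nonneg hq0 ENNReal.ofReal_ne_top),
          lintegral_indicator hBm]
    _ ≤ 2 ^ (q - 1) * (∫⁻ z, ‖fderiv ℝ u z‖ₑ ^ q ∂μ + ENNReal.ofReal (4 / s) ^ q *
          (C * (ENNReal.ofReal (2 * s) ^ q * ∫⁻ z, ‖fderiv ℝ u z‖ₑ ^ q ∂μ))) := by
        gcongr
        exact h u L hu hc x (2 * s)
    _ = _ := by
        have h8 : ENNReal.ofReal 8 ^ q =
            ENNReal.ofReal (4 / s) ^ q * ENNReal.ofReal (2 * s) ^ q := by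
          rw [← ENNReal.mul_rpow_of_nonneg _ _ hq0, ← ENNReal.ofReal_mul (by positivity)]
          congr 2
          field_simp
          norm_num
        rw [h8]
        ring

end

/-- Let `1 ≤ q < 2d`.  There is `C > 0` depending only on `d` and `q` such that: for every
`x ∈ ℂ^d`, `n ≥ 1`, compact `K ⊆ {2^{-(n+1)} ≤ |z-x| ≤ 2^{-n}}` and `ε > 0`, there is a
Lipschitz `φ` with compact support contained in `{2^{-(n+2)} ≤ |z-x| ≤ 2^{-(n-1)}}`, `φ = 1`
on `K`, and `∫ |∇φ|^q dV ≤ C(Γ_q(K) + ε)`. -/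
theorem exists_capacitary_cutoff
    (d : ℕ) (hd : 1 ≤ d) (q : ℝ) (hq1 : 1 ≤ q) (hq2 : q < 2 * d) :
    ∃ C > 0, ∀ (x : EuclideanSpace ℂ (Fin d)) (n : ℕ), 1 ≤ n →
      ∀ K : Set (EuclideanSpace ℂ (Fin d)), IsCompact K →
      K ⊆ {z | (2 : ℝ) ^ (-((n : ℤ) + 1)) ≤ dist z x ∧ dist z x ≤ (2 : ℝ) ^ (-(n : ℤ))} →
      ∀ ε : ℝ, 0 < ε →
      ∃ φ : EuclideanSpace ℂ (Fin d) → ℝ,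
        (∃ L, LipschitzWith L φ) ∧ HasCompactSupport φ ∧
        tsupport φ ⊆
          {z | (2 : ℝ) ^ (-((n : ℤ) + 2)) ≤ dist z x ∧ dist z x ≤ (2 : ℝ) ^ (-((n : ℤ) - 1))} ∧
        (∀ z ∈ K, φ z = 1) ∧
        ∫ z, ‖fderiv ℝ φ z‖ ^ q ≤ C * (capCompact q K + ε) := by
  have hfr : finrank ℝ (EuclideanSpace ℂ (Fin d)) = 2 * d := by
    rw [← finrank_mul_finrank ℝ ℂ]
    simp
  have hq0 : 0 < q := by linarith
  obtain ⟨C, hC, h⟩ := exists_annular_cutoff_lintegral_le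
    (volume : Measure (EuclideanSpace ℂ (Fin d))) hq1 (by rw [hfr]; exact_mod_cast hq2)
  refine ⟨C.toReal + 1, by positivity, fun x n _ K _ hKs ε hε => ?_⟩
  set s : ℝ := 2 ^ (-(n : ℤ)) with hs
  have hspos : 0 < s := by positivity
  have e1 : (2 : ℝ) ^ (-((n : ℤ) + 1)) = s / 2 := by
    rw [neg_add, zpow_add₀ two_ne_zero, ← hs, zpow_neg_one, div_eq_mul_inv]
  have e2 : (2 : ℝ) ^ (-((n : ℤ) + 2)) = s / 4 := by
    rw [neg_add, zpow_add₀ two_ne_zero, ← hs, div_eq_mul_inv]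
    norm_num
  have e3 : (2 : ℝ) ^ (-((n : ℤ) - 1)) = 2 * s := by
    rw [neg_sub, sub_eq_add_neg, zpow_add₀ two_ne_zero, ← hs, zpow_one]
  rw [e1] at hKs
  rw [e2, e3]
  have hcompact : ∀ f : EuclideanSpace ℂ (Fin d) → ℝ,
      tsupport f ⊆ {z | s / 4 ≤ dist z x ∧ dist z x ≤ 2 * s} → HasCompactSupport f :=
    fun f hf => (isCompact_closedBall x (2 * s)).of_isClosed_subset (isClosed_tsupport f)
      fun z hz => (hf hz).2
  obtain ⟨χ, hχL, -, hχK, hχs⟩ := exists_lipschitz_annular_cutoff x hspos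
  have hχc : HasCompactSupport χ := HasCompactSupport.intro (isCompact_closedBall x (2 * s))
    fun z hz => by_contra fun hne => hz (hχs z hne).2
  obtain ⟨t, ⟨u, ⟨L, hu⟩, hc, huK, rfl⟩, ht⟩ := exists_lt_of_csInf_lt
    (s := { t : ℝ | ∃ u : EuclideanSpace ℂ (Fin d) → ℝ, (∃ L, LipschitzWith L u) ∧
      HasCompactSupport u ∧ (∀ z ∈ K, 1 ≤ u z) ∧ t = ∫ z, ‖fderiv ℝ u z‖ ^ q })
    ⟨_, χ, ⟨_, hχL⟩, hχc, fun z hz => (hχK z (hKs hz).1 (hKs hz).2).ge, rfl⟩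
    (lt_add_of_pos_right (capCompact q K) hε)
  obtain ⟨φ, ⟨L', hφ⟩, hsupp, hφK, hle⟩ := h u L hu hc x s hspos
  have hφc := hcompact φ hsupp
  refine ⟨φ, ⟨L', hφ⟩, hφc, hsupp, fun z hz => hφK z (hKs hz).1 (hKs hz).2 (huK z hz), ?_⟩
  rw [← hφ.ofReal_integral_norm_fderiv_rpow volume hq0 hφc,
    ← hu.ofReal_integral_norm_fderiv_rpow volume hq0 hc, ← ENNReal.ofReal_toReal hC,
    ← ENNReal.ofReal_mul ENNReal.toReal_nonneg] at hle
  have hu0 : 0 ≤ ∫ z, ‖fderiv ℝ u z‖ ^ q := integral_nonneg fun z => by positivity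
  rw [ENNReal.ofReal_le_ofReal_iff (by positivity)] at hle
  calc _ ≤ C.toReal * ∫ z, ‖fderiv ℝ u z‖ ^ q := hle
    _ ≤ (C.toReal + 1) * (capCompact q K + ε) := by
      gcongr
      linarith
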